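/- (Closed-loop boundedness) Under the hypotheses of the closed-loop Lyapunov identity (Assumption 1, admissible trajectory x⋆, PI controller ż = −y, u = −K_p y + K_i z + u⋆ with K_p, K_i symmetric positive definite), every closed-loop solution (x, z) defined on [0,∞) has x̃ = x − x⋆ and z bounded: there is a constant M (depending on the initial condition) with |x̃(t)| ≤ M and |z(t)| ≤ M for all t ≥ 0. Consequently x itself is bounded. -/

import Mathlib

open Matrix

/-- The symmetric part of a square real matrix: `sym M = (1/2)(M + Mᵀ)`. -/
noncomputable def sym {k : ℕ} (M : Matrix (Fin k) (Fin k) ℝ) : Matrix (Fin k) (Fin k) ℝ :=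
  (1 / 2 : ℝ) • (M + Mᵀ)

/-- A positive definite quadratic form dominates a positive multiple of the squared norm. -/
theorem Matrix.PosDef.exists_pos_mul_sq_norm_le {k : ℕ} {M : Matrix (Fin k) (Fin k) ℝ}
    (hM : M.PosDef) : ∃ c : ℝ, 0 < c ∧ ∀ v : Fin k → ℝ, c * ‖v‖ ^ 2 ≤ v ⬝ᵥ (M *ᵥ v) := by
  have hcont : Continuous fun v : Fin k → ℝ => v ⬝ᵥ (M *ᵥ v) := by fun_prop
  obtain ⟨c, hc, h⟩ := (isCompact_sphere (0 : Fin k → ℝ) 1).exists_forall_le' (a := (0 : ℝ))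
    hcont.continuousOn (fun v hv => by
      have hv0 : v ≠ 0 := by
        rintro rfl
        simp at hv
      simpa using hM.dotProduct_mulVec_pos hv0)
  refine ⟨c, hc, fun v => ?_⟩
  rcases eq_or_ne v 0 with rfl | hv
  · simp
  have hn : 0 < ‖v‖ := norm_pos_iff.2 hv
  have h1 := h (‖v‖⁻¹ • v) (by simp [norm_smul, hn.ne'])
  simp only [mulVec_smul, dotProduct_smul, smul_dotProduct, smul_eq_mul] at h1
  calc c * ‖v‖ ^ 2 ≤ (‖v‖⁻¹ * (‖v‖⁻¹ * (v ⬝ᵥ (M *ᵥ v)))) * ‖v‖ ^ 2 := by gcongr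
    _ = v ⬝ᵥ (M *ᵥ v) := by field_simp

/-- A vector on which a coercive quadratic form is at most `C` has bounded norm. -/
theorem norm_le_of_mul_sq_norm_le {E : Type*} [SeminormedAddCommGroup E] {v : E} {c q C : ℝ}
    (hc : 0 < c) (h : c * ‖v‖ ^ 2 ≤ q) (hq : q ≤ C) : ‖v‖ ≤ √(C / c) := by
  apply Real.le_sqrt_of_sq_le
  rw [le_div_iff₀ hc]
  linarith

theorem HasDerivAt.dotProduct_mulVec_self {k : ℕ} {M : Matrix (Fin k) (Fin k) ℝ}
    (hM : Mᵀ = M) {v : ℝ → Fin k → ℝ} {v' : Fin k → ℝ} {t : ℝ} (hv : HasDerivAt v v' t) :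
    HasDerivAt (fun s => v s ⬝ᵥ (M *ᵥ v s)) (2 * (v t ⬝ᵥ (M *ᵥ v'))) t := by
  have hMv : HasDerivAt (fun s => M *ᵥ v s) (M *ᵥ v') t :=
    (M.mulVecLin.toContinuousLinearMap.hasFDerivAt (x := v t)).comp_hasDerivAt t hv
  have h := HasDerivAt.fun_sum (u := Finset.univ) fun i _ =>
    (hasDerivAt_pi.1 hv i).mul (hasDerivAt_pi.1 hMv i)
  refine h.congr_deriv ?_
  have hswap : v' ⬝ᵥ (M *ᵥ v t) = v t ⬝ᵥ (M *ᵥ v') := by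
    rw [dotProduct_mulVec, ← mulVec_transpose, hM, dotProduct_comm]
  rw [Finset.sum_add_distrib, two_mul]
  exact congrArg₂ (· + ·) hswap rfl

theorem dotProduct_sym_mulVec_self {k : ℕ} (M : Matrix (Fin k) (Fin k) ℝ) (v : Fin k → ℝ) :
    v ⬝ᵥ (sym M *ᵥ v) = v ⬝ᵥ (M *ᵥ v) := by
  have h : v ⬝ᵥ (Mᵀ *ᵥ v) = v ⬝ᵥ (M *ᵥ v) := by
    rw [mulVec_transpose, dotProduct_comm, dotProduct_mulVec]
  rw [sym, smul_mulVec, add_mulVec, dotProduct_smul, dotProduct_add, h, smul_eq_mul]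
  ring

theorem dotProduct_mulVec_of_sym_eq_zero {k : ℕ} {M : Matrix (Fin k) (Fin k) ℝ}
    (hM : sym M = 0) (v w : Fin k → ℝ) :
    (v - w) ⬝ᵥ (M *ᵥ v) = v ⬝ᵥ (M *ᵥ w) ∧ (v - w) ⬝ᵥ (M *ᵥ w) = v ⬝ᵥ (M *ᵥ w) := by
  have h0 : ∀ a : Fin k → ℝ, a ⬝ᵥ (M *ᵥ a) = 0 := fun a => by
    rw [← dotProduct_sym_mulVec_self, hM, zero_mulVec, dotProduct_zero]
  have h := h0 (v - w)
  rw [mulVec_sub, dotProduct_sub] at h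
  have hw : (v - w) ⬝ᵥ (M *ᵥ w) = v ⬝ᵥ (M *ᵥ w) := by
    rw [sub_dotProduct, h0 w, sub_zero]
  exact ⟨by linarith, hw⟩

/-- **closed-loop boundedness.** Under the hypotheses of the closed-loop
Lyapunov identity (Assumption 1, admissible trajectory `x⋆`, PI controller `ż = −y`,
`u = −Kₚ y + Kᵢ z + u⋆` with `Kₚ, Kᵢ` symmetric positive definite), every closed-loop
solution `(x, z)` defined on `[0, ∞)` has `x̃ = x − x⋆` and `z` bounded: there is a
constant `M` with `‖x̃(t)‖ ≤ M` and `‖z(t)‖ ≤ M` for all `t ≥ 0`; consequently `x`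
itself is bounded. -/
theorem stmt_7 {n m : ℕ}
    (A : Matrix (Fin n) (Fin n) ℝ) (B : Fin m → Matrix (Fin n) (Fin n) ℝ)
    (P : Matrix (Fin n) (Fin n) ℝ) (hP : P.PosDef)
    (hPA : (-sym (P * A)).PosSemidef)
    (hPB : ∀ i, sym (P * B i) = 0)
    (d : ℝ → Fin n → ℝ)
    (x xs : ℝ → Fin n → ℝ) (u us : ℝ → Fin m → ℝ)
    (hxsb : ∃ M, ∀ t, ‖xs t‖ ≤ M) (husb : ∃ M, ∀ t, ‖us t‖ ≤ M)
    (Kp Ki : Matrix (Fin m) (Fin m) ℝ) (hKp : Kp.PosDef) (hKi : Ki.PosDef)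
    (z : ℝ → Fin m → ℝ) (y : ℝ → Fin m → ℝ)
    (hy : ∀ t i, y t i = xs t ⬝ᵥ ((B i)ᵀ *ᵥ (P *ᵥ x t)))
    (hz : ∀ t, 0 ≤ t → HasDerivAt z (-(y t)) t)
    (hu : ∀ t, u t = -(Kp *ᵥ y t) + Ki *ᵥ z t + us t)
    (hx : ∀ t, 0 ≤ t → HasDerivAt x (A *ᵥ x t + d t + ∑ i, u t i • (B i *ᵥ x t)) t)
    (hxs : ∀ t, HasDerivAt xs (A *ᵥ xs t + d t + ∑ i, us t i • (B i *ᵥ xs t)) t) :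
    ∃ M : ℝ, ∀ t, 0 ≤ t →
      ‖x t - xs t‖ ≤ M ∧ ‖z t‖ ≤ M ∧ ‖x t‖ ≤ M := by
  have hPt : Pᵀ = P := by simpa using hP.isHermitian.eq
  have hKit : Kiᵀ = Ki := by simpa using hKi.isHermitian.eq
  have hyB : ∀ t i, x t ⬝ᵥ ((P * B i) *ᵥ xs t) = y t i := fun t i => by
    rw [hy, dotProduct_mulVec, ← mulVec_transpose, transpose_mul, hPt, mulVec_mulVec,
      dotProduct_comm]
  set W : ℝ → ℝ := fun t =>
    (x t - xs t) ⬝ᵥ (P *ᵥ (x t - xs t)) + z t ⬝ᵥ (Ki *ᵥ z t) with hW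
  have hderiv : ∀ t, 0 ≤ t → ∃ W' ≤ 0, HasDerivAt W W' t := by
    intro t ht
    refine ⟨_, ?_, (((hx t ht).sub (hxs t)).dotProduct_mulVec_self hPt).add
      ((hz t ht).dotProduct_mulVec_self hKit)⟩
    have hA : (x t - xs t) ⬝ᵥ ((P * A) *ᵥ (x t - xs t)) ≤ 0 := by
      have h := hPA.dotProduct_mulVec_nonneg (x t - xs t)
      rw [star_trivial, neg_mulVec, dotProduct_neg, dotProduct_sym_mulVec_self] at h
      linarith
    have hK : 0 ≤ y t ⬝ᵥ (Kp *ᵥ y t) := by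
      simpa using hKp.posSemidef.dotProduct_mulVec_nonneg (y t)
    have hinput : ∀ a b : Fin m → ℝ, (x t - xs t) ⬝ᵥ (P *ᵥ
        (A *ᵥ x t + d t + ∑ i, a i • (B i *ᵥ x t)
          - (A *ᵥ xs t + d t + ∑ i, b i • (B i *ᵥ xs t))))
        = (x t - xs t) ⬝ᵥ ((P * A) *ᵥ (x t - xs t)) + (a - b) ⬝ᵥ y t := by
      intro a b
      have hsum : (a - b) ⬝ᵥ y t = ∑ i, a i * y t i - ∑ i, b i * y t i := by
        rw [sub_dotProduct]
        rfl
      rw [hsum]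
      simp only [mulVec_sub, mulVec_add, dotProduct_sub, dotProduct_add, mulVec_sum,
        dotProduct_sum, mulVec_smul, dotProduct_smul, mulVec_mulVec, smul_eq_mul,
        (dotProduct_mulVec_of_sym_eq_zero (hPB _) (x t) (xs t)).1,
        (dotProduct_mulVec_of_sym_eq_zero (hPB _) (x t) (xs t)).2, hyB]
      ring
    have hfeedback : (u t - us t) ⬝ᵥ y t = -(y t ⬝ᵥ (Kp *ᵥ y t)) + z t ⬝ᵥ (Ki *ᵥ y t) := by
      rw [hu, add_sub_cancel_right, add_dotProduct, neg_dotProduct,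
        dotProduct_comm (Kp *ᵥ y t), dotProduct_mulVec (z t), ← mulVec_transpose, hKit]
    simp only [Pi.sub_apply]
    rw [hinput, hfeedback, mulVec_neg, dotProduct_neg]
    linarith
  have hanti : AntitoneOn W (Set.Ici 0) := by
    refine antitoneOn_of_deriv_nonpos (convex_Ici 0) (fun t ht => ?_) (fun t ht => ?_)
      (fun t ht => ?_)
    · obtain ⟨_, _, h⟩ := hderiv t ht
      exact h.continuousAt.continuousWithinAt
    · obtain ⟨_, _, h⟩ := hderiv t (interior_subset ht)
      exact h.differentiableAt.differentiableWithinAt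
    · obtain ⟨_, h0, h⟩ := hderiv t (interior_subset ht)
      rwa [h.deriv]
  obtain ⟨p, hp, hpP⟩ := hP.exists_pos_mul_sq_norm_le
  obtain ⟨q, hq, hqK⟩ := hKi.exists_pos_mul_sq_norm_le
  obtain ⟨R, hR⟩ := hxsb
  have hR0 : 0 ≤ R := (norm_nonneg _).trans (hR 0)
  refine ⟨√(W 0 / p) + √(W 0 / q) + R, fun t ht => ?_⟩
  have hWt : W t ≤ W 0 := hanti Set.self_mem_Ici ht ht
  have hxP := hpP (x t - xs t)
  have hzK := hqK (z t)
  have hx0 : 0 ≤ p * ‖x t - xs t‖ ^ 2 := by positivity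
  have hz0 : 0 ≤ q * ‖z t‖ ^ 2 := by positivity
  have hxb : ‖x t - xs t‖ ≤ √(W 0 / p) :=
    norm_le_of_mul_sq_norm_le hp hxP (by simp only [hW] at hWt ⊢; linarith)
  have hzb : ‖z t‖ ≤ √(W 0 / q) :=
    norm_le_of_mul_sq_norm_le hq hzK (by simp only [hW] at hWt ⊢; linarith)
  have hsp := Real.sqrt_nonneg (W 0 / p)
  have hsq := Real.sqrt_nonneg (W 0 / q)
  have htri : ‖x t‖ ≤ ‖x t - xs t‖ + ‖xs t‖ := norm_le_norm_sub_add _ _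
  have hRt := hR t
  exact ⟨by linarith, by linarith, by linarith⟩
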